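/- arXiv:2012.11897 — 2 statements merged into one kernel-verified Lean document; each statement's English description precedes it below -/
import Mathlib

section
/- The number of pairs (x_1,x_2) ∈ F_q² with x_1³ + x_2³ = −1 equals q + c − 2, where c is the integer uniquely determined by: 4q = c² + 27d² for some integer d, c ≡ 1 (mod 3), and gcd(c,p) = 1 whenever p ≡ 1 (mod 3). -/
theorem not_prime_dvd_choose_of_lt {p n k : ℕ} (hp : p.Prime) (hk : k ≤ n) (hn : n < p) :
    ¬ p ∣ n.choose k := fun h ↦ by
  have h1 : p ∣ n.factorial := by
    rw [← Nat.choose_mul_factorial_mul_factorial hk, mul_assoc]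
    exact h.mul_right _
  exact absurd ((Nat.Prime.dvd_factorial hp).1 h1) (by omega)

theorem not_prime_dvd_choose_two_mul {p : ℕ} [Fact p.Prime] (hp3 : p % 3 = 1) (k m : ℕ)
    (hm : 3 * m + 1 = p ^ k) : ¬ p ∣ (2 * m).choose m := by
  have hp : p.Prime := Fact.out
  induction k generalizing m with
  | zero =>
    obtain rfl : m = 0 := by simpa using hm
    simpa using hp.one_lt.ne'
  | succ k ih =>
    obtain ⟨n, hn⟩ : ∃ n, 3 * n + 1 = p ^ k := by
      have : p ^ k % 3 = 1 := by rw [Nat.pow_mod, hp3, one_pow, Nat.one_mod]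
      exact ⟨p ^ k / 3, by omega⟩
    obtain ⟨s, hs⟩ : ∃ s, p = 3 * s + 1 := ⟨p / 3, by omega⟩
    have hmn : m = s + p * n := by
      rw [pow_succ, ← hn] at hm
      have : p * n = 3 * s * n + n := by rw [hs]; ring
      have : 3 * (p * n) + p = (3 * n + 1) * p := by ring
      omega
    have h2m : 2 * m = 2 * s + p * (2 * n) := by rw [hmn]; ring
    have lucas := Choose.choose_modEq_choose_mod_mul_choose_div_nat (n := 2 * m) (k := m) (p := p)
    rw [h2m, hmn, Nat.add_mul_mod_self_left, Nat.add_mul_mod_self_left,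
      Nat.mod_eq_of_lt (by omega : 2 * s < p), Nat.mod_eq_of_lt (by omega : s < p),
      Nat.add_mul_div_left _ _ hp.pos, Nat.add_mul_div_left _ _ hp.pos,
      Nat.div_eq_of_lt (by omega : 2 * s < p), Nat.div_eq_of_lt (by omega : s < p), zero_add,
      zero_add] at lucas
    rw [hmn, show 2 * (s + p * n) = 2 * s + p * (2 * n) by ring, lucas.dvd_iff dvd_rfl, hp.dvd_mul]
    exact not_or.2 ⟨not_prime_dvd_choose_of_lt hp (by omega) (by omega), ih n hn⟩

/-- Power sums over a finite field. -/
theorem FiniteField.sum_pow_eq_ite {K : Type*} [Field K] [Fintype K] {i : ℕ} (hi : i ≠ 0) :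
    ∑ x : K, x ^ i = if Fintype.card K - 1 ∣ i then -1 else 0 := by
  classical
  rw [← FiniteField.sum_pow_units K i, ← Finset.sum_sdiff ({0} : Finset K).subset_univ,
    Finset.sum_singleton, zero_pow hi, add_zero]
  refine (Finset.sum_bij (fun (x : Kˣ) _ ↦ (x : K)) ?_ ?_ ?_ ?_).symm
  · simp
  · intro a _ b _ h
    exact Units.ext h
  · intro b hb
    exact ⟨Units.mk0 b (by simpa using hb), by simp, rfl⟩
  · simp

theorem sum_pow_mul_one_sub_pow {K : Type*} [Field K] [Fintype K] {m : ℕ} (hm0 : m ≠ 0)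
    (hm : Fintype.card K = 3 * m + 1) :
    ∑ x : K, x ^ m * (1 - x) ^ m = 0 ∧
    ∑ x : K, x ^ (2 * m) * (1 - x) ^ (2 * m) = - ((-1) ^ m * ((2 * m).choose m : K)) := by
  have expand (n : ℕ) : ∑ x : K, x ^ n * (1 - x) ^ n =
      ∑ j ∈ Finset.range (n + 1), (-1) ^ j * (n.choose j : K) * ∑ x : K, x ^ (n + j) := by
    simp_rw [Finset.mul_sum]
    rw [Finset.sum_comm]
    refine Finset.sum_congr rfl fun x _ ↦ ?_
    rw [sub_eq_add_neg, add_comm (1 : K), add_pow, Finset.mul_sum]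
    refine Finset.sum_congr rfl fun j _ ↦ ?_
    rw [neg_pow, one_pow, pow_add]
    ring
  constructor
  · rw [expand]
    refine Finset.sum_eq_zero fun j hj ↦ ?_
    rw [FiniteField.sum_pow_lt_card_sub_one, mul_zero]
    have := Finset.mem_range.1 hj
    omega
  · rw [expand, Finset.sum_eq_single_of_mem m (by simp; omega)]
    · rw [FiniteField.sum_pow_eq_ite (by omega), if_pos ⟨1, by omega⟩]
      ring
    · intro j hj hjm
      have := Finset.mem_range.1 hj
      rw [FiniteField.sum_pow_eq_ite (by omega), if_neg, mul_zero]
      rintro ⟨t, ht⟩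
      rw [hm, Nat.add_sub_cancel] at ht
      rcases t with _ | _ | t
      · omega
      · omega
      · have : 3 * m * (t + 1 + 1) = 3 * (m * t) + 6 * m := by ring
        omega

theorem exists_isPrimitiveRoot_three {F : Type*} [Field F] [Fintype F] {m : ℕ}
    (hm : Fintype.card F = 3 * m + 1) : ∃ ζ : F, IsPrimitiveRoot ζ 3 := by
  classical
  have hm0 : 1 < Fintype.card F := Fintype.one_lt_card
  obtain ⟨g, hg⟩ := IsCyclic.exists_generator (α := Fˣ)
  have hord : orderOf g = m * 3 := by
    rw [orderOf_eq_card_of_forall_mem_zpowers hg, Nat.card_eq_fintype_card, Fintype.card_units]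
    omega
  have h := (IsPrimitiveRoot.orderOf g).pow (by omega) hord
  exact ⟨_, h.map_of_injective (f := Units.coeHom F) Units.val_injective⟩

theorem card_cube_eq {F R : Type*} [Field F] [Fintype F] [DecidableEq F] [CommRing R] [IsDomain R]
    {ζ : F} (hζ : IsPrimitiveRoot ζ 3) {χ : MulChar F R} (hχ1 : χ ≠ 1) (hχ3 : χ ^ 3 = 1) (a : F) :
    (Fintype.card {x : F // x ^ 3 = a} : R) = 1 + χ a + χ⁻¹ a := by
  have hinv (a : F) : χ⁻¹ a = χ a ^ 2 := by
    rw [← χ.pow_apply' two_ne_zero, inv_eq_of_mul_eq_one_right ((pow_succ' χ 2).symm.trans hχ3)]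
  rw [hinv]
  rcases eq_or_ne a 0 with rfl | ha
  · have : Unique {x : F // x ^ 3 = 0} :=
      { default := ⟨0, by simp⟩, uniq := fun x ↦ Subtype.ext (by simpa using x.2) }
    rw [Fintype.card_unique, χ.map_zero]
    simp
  have hcube (b : F) (hb : b ≠ 0) : χ b ^ 3 = 1 := by
    rw [← χ.pow_apply' three_ne_zero, hχ3, MulChar.one_apply hb.isUnit]
  have hcard [Decidable (∃ α, α ^ 3 = a)] :
      Fintype.card {x : F // x ^ 3 = a} = if ∃ α, α ^ 3 = a then 3 else 0 := by
    trans (Polynomial.nthRoots 3 a).card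
    swap
    · rw [hζ.card_nthRoots a]
      congr
    rw [← Multiset.toFinset_card_of_nodup (hζ.nthRoots_nodup ha),
      Fintype.card_subtype]
    congr 1
    ext x
    simp [Polynomial.mem_nthRoots]
  classical
  rw [hcard]
  split_ifs with h
  · obtain ⟨b, rfl⟩ := h
    have hb : b ≠ 0 := by rintro rfl; simp at ha
    rw [map_pow, hcube b hb]
    norm_num
  · have hne : χ a ≠ 1 := by
      intro h1
      obtain ⟨g, hg⟩ := IsCyclic.exists_monoid_generator (α := Fˣ)
      obtain ⟨n, hn⟩ := hg (Units.mk0 a ha)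
      have hn : (g : F) ^ n = a := by simpa using congrArg Units.val hn
      have hg1 : χ g ≠ 1 := by
        intro hg1
        refine hχ1 (MulChar.eq_one_iff.2 fun u ↦ ?_)
        obtain ⟨j, rfl⟩ := hg u
        simp [hg1]
      have hord : orderOf (χ g) = 3 := orderOf_eq_prime (hcube g g.ne_zero) hg1
      have hdvd : 3 ∣ n := by
        rw [← hord]
        exact orderOf_dvd_of_pow_eq_one (by rw [← map_pow, hn, h1])
      obtain ⟨t, rfl⟩ := hdvd
      exact h ⟨(g : F) ^ t, by rw [← hn]; ring⟩
    have h3 := hcube a ha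
    have : (χ a - 1) * (1 + χ a + χ a ^ 2) = 0 := by linear_combination h3
    simpa using (((mul_eq_zero.1 this).resolve_left (sub_ne_zero.2 hne))).symm

theorem card_sum_cubes_eq_neg_one {F R : Type*} [Field F] [Fintype F] [DecidableEq F] [CommRing R]
    [IsDomain R] {ζ : F} (hζ : IsPrimitiveRoot ζ 3) {χ : MulChar F R} (hχ1 : χ ≠ 1)
    (hχ3 : χ ^ 3 = 1) :
    (Nat.card {x : F × F // x.1 ^ 3 + x.2 ^ 3 = -1} : R) =
      Fintype.card F - 2 + jacobiSum χ χ + jacobiSum χ⁻¹ χ⁻¹ := by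
  have hext (s t : Σ u : F, {x : F // x ^ 3 = u} × {y : F // y ^ 3 = 1 - u})
      (h₁ : s.2.1.1 = t.2.1.1) (h₂ : s.2.2.1 = t.2.2.1) : s = t := by
    obtain ⟨_, ⟨x, rfl⟩, y, hy⟩ := s
    obtain ⟨_, ⟨x', rfl⟩, y', hy'⟩ := t
    obtain rfl : x = x' := h₁
    obtain rfl : y = y' := h₂
    rfl
  have e : {x : F × F // x.1 ^ 3 + x.2 ^ 3 = -1} ≃
      Σ u : F, {x : F // x ^ 3 = u} × {y : F // y ^ 3 = 1 - u} :=
    { toFun := fun x ↦ ⟨(-x.1.1) ^ 3, ⟨-x.1.1, rfl⟩, ⟨-x.1.2, by linear_combination -x.2⟩⟩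
      invFun := fun y ↦ ⟨(-y.2.1.1, -y.2.2.1), by
        linear_combination -y.2.1.2 - y.2.2.2⟩
      left_inv := fun x ↦ by simp
      right_inv := fun y ↦ hext _ _ (neg_neg _) (neg_neg _) }
  rw [Nat.card_congr e, Nat.card_eq_fintype_card, Fintype.card_sigma]
  push_cast [Fintype.card_prod, card_cube_eq hζ hχ1 hχ3]
  have hinv1 : χ⁻¹ ≠ 1 := inv_ne_one.2 hχ1
  have expand (u : F) : (1 + χ u + χ⁻¹ u) * (1 + χ (1 - u) + χ⁻¹ (1 - u)) =
      1 + χ u + χ⁻¹ u + χ (1 - u) + χ⁻¹ (1 - u) + χ u * χ (1 - u) + χ u * χ⁻¹ (1 - u) +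
      χ⁻¹ u * χ (1 - u) + χ⁻¹ u * χ⁻¹ (1 - u) := by ring
  have hsub (ψ : MulChar F R) : ∑ u, ψ (1 - u) = ∑ u, ψ u := (Equiv.subLeft 1).sum_comp ψ
  simp_rw [expand, Finset.sum_add_distrib, hsub, MulChar.sum_eq_zero_of_ne_one hχ1,
    MulChar.sum_eq_zero_of_ne_one hinv1, ← jacobiSum.eq_1]
  rw [jacobiSum_comm χ⁻¹ χ, jacobiSum_nontrivial_inv hχ1,
    MulChar.val_neg_one_eq_one_of_odd_order (n := 3) (by decide) hχ3]
  simp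
  ring

theorem dvd_of_dvd_sq_add_three_mul_sq {p : ℕ} [Fact p.Prime] (hp3 : p % 3 = 2) (hp2 : p ≠ 2)
    {a b : ℤ} (h : (p : ℤ) ∣ a ^ 2 + 3 * b ^ 2) : (p : ℤ) ∣ b := by
  have hp : p.Prime := Fact.out
  rw [← ZMod.intCast_zmod_eq_zero_iff_dvd] at h ⊢
  push_cast at h
  by_contra hb
  have h2 : (2 : ZMod p) ≠ 0 := by
    intro h0
    have : p ∣ 2 := (ZMod.natCast_eq_zero_iff 2 p).1 (by exact_mod_cast h0)
    exact hp2 ((Nat.prime_dvd_prime_iff_eq hp Nat.prime_two).1 this)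
  have h3 : (3 : ZMod p) ≠ 0 := by
    intro h0
    have : p ∣ 3 := (ZMod.natCast_eq_zero_iff 3 p).1 (by exact_mod_cast h0)
    have := (Nat.prime_dvd_prime_iff_eq hp Nat.prime_three).1 this
    omega
  set t : ZMod p := a / b with ht
  have ht2 : t ^ 2 = -3 := by
    rw [ht]; field_simp; linear_combination h
  set w : ZMod p := (t - 1) / 2 with hw
  have hw' : 2 * w = t - 1 := by rw [hw]; field_simp
  have hww : w ^ 2 + w + 1 = 0 := by
    have : 2 ^ 2 * (w ^ 2 + w + 1) = 0 := by
      linear_combination (2 * w + t + 1) * hw' + ht2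
    exact (mul_eq_zero.1 this).resolve_left (pow_ne_zero 2 h2)
  have hw3 : w ^ 3 = 1 := by linear_combination (w - 1) * hww
  have hw1 : w ≠ 1 := by
    intro h1
    rw [h1] at hww
    exact h3 (by linear_combination hww)
  have hw0 : w ≠ 0 := by
    intro h1
    rw [h1] at hw3
    simp at hw3
  have hord : orderOf w = 3 := orderOf_eq_prime hw3 hw1
  have := hord ▸ ZMod.orderOf_dvd_card_sub_one hw0
  have := hp.two_le
  omega

theorem eq_zero_of_four_mul_sq_eq {p : ℕ} [Fact p.Prime] (hp3 : p % 3 = 2) (m : ℕ) {c d : ℤ}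
    (h : 4 * (p : ℤ) ^ (2 * m) = c ^ 2 + 27 * d ^ 2) : d = 0 := by
  have hp : p.Prime := Fact.out
  have hpZ : Prime (p : ℤ) := Nat.prime_iff_prime_int.1 hp
  induction m generalizing c d with
  | zero =>
    rw [mul_zero, pow_zero] at h
    have : d ^ 2 = 0 := by nlinarith [sq_nonneg c, sq_nonneg d]
    simpa using this
  | succ m ih =>
    obtain ⟨hc, hd⟩ : (p : ℤ) ∣ c ∧ (p : ℤ) ∣ d := by
      rcases eq_or_ne p 2 with rfl | hp2
      · have h16 : c ^ 2 + 27 * d ^ 2 = 16 * 2 ^ (2 * m) := by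
          rw [← h]; push_cast; ring
        rcases Int.even_or_odd' c with ⟨c', rfl | rfl⟩ <;>
        rcases Int.even_or_odd' d with ⟨d', rfl | rfl⟩
        · exact ⟨⟨c', rfl⟩, ⟨d', rfl⟩⟩
        · exfalso; ring_nf at h16; omega
        · exfalso; ring_nf at h16; omega
        · exfalso
          obtain ⟨s, hs⟩ := Int.even_mul_succ_self c'
          obtain ⟨t, ht⟩ := Int.even_mul_succ_self d'
          have : 1 + 8 * s + 27 * (1 + 8 * t) = 16 * 2 ^ (2 * m) := by
            linear_combination h16 - 4 * hs - 108 * ht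
          omega
      · have hdvd : (p : ℤ) ∣ c ^ 2 + 27 * d ^ 2 := by
          rw [← h]
          exact (dvd_pow_self _ (by omega)).mul_left _
        have h3 : ¬ (p : ℤ) ∣ 3 := by
          intro h0
          have := (Nat.prime_dvd_prime_iff_eq hp Nat.prime_three).1 (by exact_mod_cast h0)
          omega
        have hd : (p : ℤ) ∣ d := (hpZ.dvd_or_dvd (dvd_of_dvd_sq_add_three_mul_sq hp3 hp2
          (a := c) (b := 3 * d) (by convert hdvd using 1; ring))).resolve_left h3
        refine ⟨hpZ.dvd_of_dvd_pow ((dvd_add_left ?_).1 hdvd), hd⟩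
        exact (dvd_pow hd two_ne_zero).mul_left _
    obtain ⟨c, rfl⟩ := hc
    obtain ⟨d, rfl⟩ := hd
    rw [ih (c := c) (d := d), mul_zero]
    have hp0 : (p : ℤ) ^ 2 ≠ 0 := pow_ne_zero 2 hpZ.ne_zero
    refine mul_left_cancel₀ hp0 ?_
    linear_combination h

theorem eq_of_sq_eq_of_mod_three {a b : ℤ} (h : a ^ 2 = b ^ 2) (ha : a % 3 = 1)
    (hb : b % 3 = 1) : a = b := by
  rcases sq_eq_sq_iff_eq_or_eq_neg.1 h with h | h <;> omega

theorem eq_of_four_mul_pow_eq_of_inert {p k : ℕ} [Fact p.Prime] (hp3 : p % 3 = 2)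
    (hq3 : p ^ k % 3 = 1) {a b c d : ℤ} (hab : 4 * (p : ℤ) ^ k = a ^ 2 + 27 * b ^ 2)
    (hcd : 4 * (p : ℤ) ^ k = c ^ 2 + 27 * d ^ 2) (ha : a % 3 = 1) (hc : c % 3 = 1) : a = c := by
  obtain ⟨m, rfl⟩ : ∃ m, k = 2 * m := by
    rcases Nat.even_or_odd' k with ⟨m, rfl | rfl⟩
    · exact ⟨m, rfl⟩
    · rw [pow_succ, pow_mul, Nat.mul_mod, Nat.pow_mod, Nat.pow_mod p, hp3] at hq3
      simp at hq3
  rw [eq_zero_of_four_mul_sq_eq hp3 m hab] at hab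
  rw [eq_zero_of_four_mul_sq_eq hp3 m hcd] at hcd
  exact eq_of_sq_eq_of_mod_three (by linear_combination hcd - hab) ha hc

theorem eq_of_four_mul_pow_eq_of_split {p k : ℕ} [Fact p.Prime] (hp3 : p % 3 = 1)
    {a b c d : ℤ} (hab : 4 * (p : ℤ) ^ k = a ^ 2 + 27 * b ^ 2)
    (hcd : 4 * (p : ℤ) ^ k = c ^ 2 + 27 * d ^ 2) (ha : a % 3 = 1) (hc : c % 3 = 1)
    (hpa : ¬ (p : ℤ) ∣ a) (hpc : ¬ (p : ℤ) ∣ c) : a = c := by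
  have hp : p.Prime := Fact.out
  have hpZ : Prime (p : ℤ) := Nat.prime_iff_prime_int.1 hp
  have hq0 : (0 : ℤ) < (p : ℤ) ^ k := by positivity [hp.pos]
  rcases Nat.eq_zero_or_pos k with rfl | hk
  · have hb : b ^ 2 < 1 := by nlinarith [sq_nonneg a]
    have hd : d ^ 2 < 1 := by nlinarith [sq_nonneg c]
    have hb : b ^ 2 = 0 := by nlinarith [sq_nonneg b]
    have hd : d ^ 2 = 0 := by nlinarith [sq_nonneg d]
    exact eq_of_sq_eq_of_mod_three (by linear_combination hcd - hab - 27 * hb + 27 * hd) ha hc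
  have hpq : (p : ℤ) ∣ (p : ℤ) ^ k := dvd_pow_self _ hk.ne'
  have hpb : ¬ (p : ℤ) ∣ b := fun h ↦ hpa <| hpZ.dvd_of_dvd_pow <|
    (dvd_add_left ((dvd_pow h two_ne_zero).mul_left 27)).1 (hab ▸ hpq.mul_left 4)
  have hprod : (c * b - a * d) * (c * b + a * d) = (p : ℤ) ^ k * (4 * (b ^ 2 - d ^ 2)) := by
    linear_combination d ^ 2 * hab - b ^ 2 * hcd
  have key (e : ℤ) (he : 4 * (p : ℤ) ^ k = c ^ 2 + 27 * e ^ 2)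
      (hdvd : (p : ℤ) ^ k ∣ c * b - a * e) : a = c := by
    obtain ⟨f, hf⟩ := hdvd
    have h16 : (c * a + 27 * e * b) ^ 2 + 27 * ((p : ℤ) ^ k * f) ^ 2 = 16 * ((p : ℤ) ^ k) ^ 2 := by
      rw [← hf]
      linear_combination (-4 * (p : ℤ) ^ k) * he - (c ^ 2 + 27 * e ^ 2) * hab
    have hf1 : f ^ 2 < 1 := by
      by_contra! hf1
      nlinarith [sq_nonneg (c * a + 27 * e * b), pow_pos hq0 2,
        mul_le_mul_of_nonneg_left hf1 (pow_pos hq0 2).le]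
    obtain rfl : f = 0 := by
      have : f ^ 2 = 0 := by nlinarith [sq_nonneg f]
      simpa using this
    have hbe : (p : ℤ) ^ k * (4 * (b ^ 2 - e ^ 2)) = 0 := by
      linear_combination (c * b + a * e) * hf + b ^ 2 * he - e ^ 2 * hab
    have hbe : 4 * (b ^ 2 - e ^ 2) = 0 := (mul_eq_zero.1 hbe).resolve_left hq0.ne'
    exact eq_of_sq_eq_of_mod_three (by linarith) ha hc
  by_cases h : (p : ℤ) ∣ c * b - a * d
  · refine key d hcd (hpZ.pow_dvd_of_dvd_mul_right k (fun h' ↦ ?_) (Dvd.intro _ hprod.symm))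
    have h2 : (p : ℤ) ∣ 2 * (c * b) := by
      have : 2 * (c * b) = (c * b - a * d) + (c * b + a * d) := by ring
      exact this ▸ dvd_add h h'
    rcases hpZ.dvd_or_dvd h2 with h2 | h2
    · have : p ∣ 2 := by exact_mod_cast h2
      have := (Nat.prime_dvd_prime_iff_eq hp Nat.prime_two).1 this
      omega
    · exact (hpZ.dvd_or_dvd h2).elim hpc hpb
  · refine key (-d) (by linear_combination hcd) ?_
    have := hpZ.pow_dvd_of_dvd_mul_left k h (Dvd.intro _ hprod.symm)
    rwa [mul_neg, sub_neg_eq_add]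

theorem exists_add_mul_of_mem_adjoin {R : Type*} [CommRing R] {μ : R} (hμ : μ ^ 2 + μ + 1 = 0)
    {z : R} (hz : z ∈ Algebra.adjoin ℤ {μ}) : ∃ x y : ℤ, z = x + y * μ := by
  induction hz using Algebra.adjoin_induction with
  | mem z hz => exact ⟨0, 1, by simpa using hz⟩
  | algebraMap n => exact ⟨n, 0, by simp⟩
  | add z w _ _ hz hw =>
    obtain ⟨x, y, rfl⟩ := hz
    obtain ⟨x', y', rfl⟩ := hw
    exact ⟨x + x', y + y', by push_cast; ring⟩
  | mul z w _ _ hz hw =>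
    obtain ⟨x, y, rfl⟩ := hz
    obtain ⟨x', y', rfl⟩ := hw
    exact ⟨x * x' - y * y', x * y' + y * x' - y * y', by
      push_cast; linear_combination (y * y' : R) * hμ⟩

/-- The trace of the cubic Jacobi sum `J(χ, χ)` is the normalised integer `c` with
`4q = c² + 27d²`. -/
theorem exists_jacobiSum_add_jacobiSum_inv_eq {F : Type*} [Field F] [Fintype F]
    (h3 : 3 ∣ Fintype.card F - 1) {χ : MulChar F ℂ} (hχ1 : χ ≠ 1) (hχ3 : χ ^ 3 = 1) :
    ∃ c d : ℤ, jacobiSum χ χ + jacobiSum χ⁻¹ χ⁻¹ = c ∧ c % 3 = 1 ∧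
      4 * (Fintype.card F : ℤ) = c ^ 2 + 27 * d ^ 2 := by
  obtain ⟨μ, hμ⟩ : ∃ μ : ℂ, IsPrimitiveRoot μ 3 := ⟨_, Complex.isPrimitiveRoot_exp 3 three_ne_zero⟩
  have hμ2 : μ ^ 2 + μ + 1 = 0 := by
    have := hμ.geom_sum_eq_zero (by norm_num)
    simp only [Finset.sum_range_succ, Finset.sum_range_zero] at this
    linear_combination this
  have hconj : (starRingEnd ℂ) μ = μ ^ 2 := by
    rw [← Complex.inv_eq_conj (Complex.norm_eq_one_of_pow_eq_one hμ.pow_eq_one three_ne_zero)]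
    exact inv_eq_of_mul_eq_one_right (by rw [← hμ.pow_eq_one]; ring)
  obtain ⟨z, hz, hJ⟩ := exists_jacobiSum_eq_neg_one_add (by norm_num) hχ3 hχ3 h3 hμ
  obtain ⟨x, y, rfl⟩ := exists_add_mul_of_mem_adjoin hμ2 hz
  have hinv : χ⁻¹ = χ.ringHomComp (starRingEnd ℂ) := by
    rw [← MulChar.star_eq_inv]
    rfl
  have hJ' : jacobiSum χ⁻¹ χ⁻¹ = -1 + (x + y * μ ^ 2) * (μ ^ 2 - 1) ^ 2 := by
    rw [hinv, jacobiSum_ringHomComp, hJ]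
    simp [hconj]
  have hχχ : χ * χ ≠ 1 := fun h ↦ hχ1 <| by
    rw [← hχ3, pow_succ, pow_two, h, one_mul]
  obtain ⟨n, hn, -⟩ := FiniteField.card F (ringChar F)
  have hnorm := jacobiSum_mul_jacobiSum_inv
    (by rw [ringChar.eq ℂ 0]; exact hn.ne_zero.symm) hχ1 hχ1 hχχ
  have e1 : jacobiSum χ χ = (-1 + 3 * y) + (3 * y - 3 * x) * μ := by
    rw [hJ]
    linear_combination (x + y * (μ - 3)) * hμ2
  have e2 : jacobiSum χ⁻¹ χ⁻¹ = (-1 + 3 * x) - (3 * y - 3 * x) * μ := by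
    rw [hJ']
    linear_combination (x * (μ ^ 2 - μ - 2) + y * (μ ^ 4 - μ ^ 3 - 2 * μ ^ 2 + 3 * μ)) * hμ2
  refine ⟨3 * x + 3 * y - 2, y - x, ?_, by omega, ?_⟩
  · rw [e1, e2]
    push_cast
    ring
  · rw [e1, e2] at hnorm
    have : 4 * (Fintype.card F : ℂ) = (3 * x + 3 * y - 2) ^ 2 + 27 * (y - x) ^ 2 := by
      rw [← hnorm]
      linear_combination (-36 * (y - x) ^ 2) * hμ2
    exact_mod_cast this

theorem card_sum_cubes_eq_neg_one_cast_ne {F : Type*} [Field F] [Fintype F] {p k m : ℕ}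
    [Fact p.Prime] [CharP F p] (hp3 : p % 3 = 1) (hm : Fintype.card F = 3 * m + 1)
    (hk : 3 * m + 1 = p ^ k) :
    (Nat.card {x : F × F // x.1 ^ 3 + x.2 ^ 3 = -1} : F) ≠ Fintype.card F - 2 := by
  classical
  have hm0 : m ≠ 0 := by
    rintro rfl
    exact Fintype.one_lt_card.ne' hm
  obtain ⟨ζ, hζ⟩ := exists_isPrimitiveRoot_three hm
  set θ : MulChar F F := MulChar.ofUnitHom (MonoidHom.id Fˣ) with hθ
  have hθa (a : F) : θ a = a := by
    rcases eq_or_ne a 0 with rfl | ha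
    · exact θ.map_zero
    · exact MulChar.ofUnitHom_coe (MonoidHom.id Fˣ) (Units.mk0 a ha)
  have hθ3 : (θ ^ m) ^ 3 = 1 := by
    rw [← pow_mul, ← θ.pow_card_eq_one, Fintype.card_units, hm, mul_comm, Nat.add_sub_cancel]
  have hpow {n : ℕ} (hn : n ≠ 0) (a : F) : (θ ^ n) a = a ^ n := by
    rw [θ.pow_apply' hn, hθa]
  have hθ1 : θ ^ m ≠ 1 := by
    intro h
    obtain ⟨g, hg⟩ := IsCyclic.exists_generator (α := Fˣ)
    have hg1 : g ^ m = 1 := by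
      ext
      rw [Units.val_pow_eq_pow_val, ← hpow hm0, h, MulChar.one_apply_coe, Units.val_one]
    have := Nat.le_of_dvd (by omega) (orderOf_dvd_of_pow_eq_one hg1)
    rw [orderOf_eq_card_of_forall_mem_zpowers hg, Nat.card_eq_fintype_card,
      Fintype.card_units] at this
    omega
  have hinv : (θ ^ m)⁻¹ = θ ^ (2 * m) := by
    refine inv_eq_of_mul_eq_one_right ?_
    rw [← hθ3, ← pow_add, ← pow_mul]
    congr 1
    ring
  obtain ⟨hJ1, hJ2⟩ := sum_pow_mul_one_sub_pow hm0 hm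
  have h2m : 2 * m ≠ 0 := by omega
  rw [card_sum_cubes_eq_neg_one hζ hθ1 hθ3, hinv]
  simp only [jacobiSum, hpow hm0, hpow h2m, hJ1, hJ2, add_zero]
  rw [← sub_eq_add_neg, Ne, sub_eq_self, mul_eq_zero, CharP.cast_eq_zero_iff F p]
  exact not_or.2 ⟨pow_ne_zero _ (neg_ne_zero.2 one_ne_zero),
    not_prime_dvd_choose_two_mul hp3 k m hk⟩

/-- The number of pairs `(x₁,x₂) ∈ F_q²` with `x₁³ + x₂³ = -1` equals
`q + c - 2`, where `c` is determined by `4q = c² + 27d²`, `c ≡ 1 (mod 3)`,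
and `gcd(c,p) = 1` whenever `p ≡ 1 (mod 3)`. -/
theorem N2_neg_one
    (p k q : ℕ) [Fact p.Prime] (hk : 0 < k) (hq : q = p ^ k) (hq3 : q % 3 = 1)
    (F : Type) [Field F] [Fintype F] (hF : Fintype.card F = q)
    (c d : ℤ) (h4q : 4 * (q : ℤ) = c ^ 2 + 27 * d ^ 2) (hc3 : c % 3 = 1)
    (hcp : p % 3 = 1 → IsCoprime c (p : ℤ)) :
    (Nat.card {x : F × F // x.1 ^ 3 + x.2 ^ 3 = -1} : ℤ) = (q : ℤ) + c - 2 := by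
  classical
  have hp : p.Prime := Fact.out
  obtain ⟨m, hm⟩ : ∃ m, q = 3 * m + 1 := ⟨q / 3, by omega⟩
  have h3 : 3 ∣ Fintype.card F - 1 := ⟨m, by omega⟩
  obtain ⟨ζ, hζ⟩ := exists_isPrimitiveRoot_three (hF.trans hm)
  obtain ⟨χ, hχ⟩ := MulChar.exists_mulChar_orderOf F h3
    (Complex.isPrimitiveRoot_exp 3 three_ne_zero)
  have hχ3 : χ ^ 3 = 1 := hχ ▸ pow_orderOf_eq_one χ
  have hχ1 : χ ≠ 1 := by
    rintro rfl
    simp at hχ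
  obtain ⟨a, b, hJ, ha3, hab⟩ := exists_jacobiSum_add_jacobiSum_inv_eq h3 hχ1 hχ3
  have hN : (Nat.card {x : F × F // x.1 ^ 3 + x.2 ^ 3 = -1} : ℤ) = (q : ℤ) + a - 2 := by
    have h := card_sum_cubes_eq_neg_one hζ hχ1 hχ3
    rw [add_assoc, hJ, hF] at h
    have : (Nat.card {x : F × F // x.1 ^ 3 + x.2 ^ 3 = -1} : ℂ) = q + a - 2 := by
      rw [h]
      ring
    exact_mod_cast this
  suffices a = c by rw [hN, this]
  rw [hF] at hab
  rw [hq, Nat.cast_pow] at hab h4q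
  have hp3 : p % 3 = 1 ∨ p % 3 = 2 := by
    have : p % 3 ≠ 0 := fun h ↦ by
      rw [hq, Nat.pow_mod, h, zero_pow hk.ne'] at hq3
      simp at hq3
    omega
  rcases hp3 with hp3 | hp3
  · have : CharP F p := charP_of_card_eq_prime_pow (hF.trans hq)
    refine eq_of_four_mul_pow_eq_of_split hp3 hab h4q ha3 hc3 (fun hpa ↦ ?_) (fun hpc ↦ ?_)
    · refine card_sum_cubes_eq_neg_one_cast_ne (F := F) hp3 (hF.trans hm) (hm ▸ hq) ?_
      have h := congrArg (Int.cast : ℤ → F) hN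
      push_cast at h
      rw [h, (CharP.intCast_eq_zero_iff F p a).2 hpa, hF, add_zero]
    · exact (Nat.prime_iff_prime_int.1 hp).not_isUnit ((hcp hp3).isUnit_of_dvd' hpc dvd_rfl)
  · exact eq_of_four_mul_pow_eq_of_inert hp3 (hq ▸ hq3) hab h4q ha3 hc3
end

section
/- One has N_2(0) = 3q − 2 and N_3(0) = q² + cq − c, where c is the integer uniquely determined by: 4q = c² + 27d² for some integer d, c ≡ 1 (mod 3), and gcd(c,p) = 1 whenever p ≡ 1 (mod 3). -/
/-- `Ncube F s z` is the number of `s`-tuples `(x₁, …, x_s) ∈ F^s` with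
`x₁³ + ⋯ + x_s³ = z`. -/
noncomputable def Ncube (F : Type) [Field F] [Fintype F] (s : ℕ) (z : F) : ℕ :=
  Nat.card {x : Fin s → F // ∑ i, x i ^ 3 = z}

section Counting

variable {F : Type} [Field F] [Fintype F]

lemma Ncube_succ (s : ℕ) (z : F) : Ncube F (s + 1) z = ∑ x : F, Ncube F s (z - x ^ 3) := by
  unfold Ncube
  rw [← Nat.card_sigma]
  refine Nat.card_congr
    { toFun := fun x ↦ ⟨x.1 0, Fin.tail x.1, ?_⟩
      invFun := fun y ↦ ⟨Fin.cons y.1 y.2.1, ?_⟩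
      left_inv := fun x ↦ by simp
      right_inv := fun y ↦ rfl }
  · have h := x.2
    rw [Fin.sum_univ_succ] at h
    exact eq_sub_of_add_eq' h
  · have h := y.2.2
    rw [Fin.sum_univ_succ]
    simp [h]

lemma Ncube_zero (z : F) [Decidable (z = 0)] : Ncube F 0 z = if z = 0 then 1 else 0 := by
  unfold Ncube
  split_ifs with h
  · simp [h]
  · simp [Ne.symm h]

lemma Ncube_cube_mul (s : ℕ) {t : F} (ht : t ≠ 0) (z : F) :
    Ncube F s (t ^ 3 * z) = Ncube F s z := by
  unfold Ncube
  symm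
  refine Nat.card_congr ((Equiv.piCongrRight fun _ ↦ Equiv.mulLeft₀ t ht).subtypeEquiv fun x ↦ ?_)
  simp [mul_pow, ← Finset.mul_sum, ht]

lemma Ncube_succ_zero (s : ℕ) :
    Ncube F (s + 1) 0 = Ncube F s 0 + (Fintype.card F - 1) * Ncube F s 1 := by
  classical
  rw [Ncube_succ, ← Finset.add_sum_erase _ _ (Finset.mem_univ (0 : F))]
  congr 1
  · simp
  · rw [Finset.sum_congr rfl (g := fun _ ↦ Ncube F s 1)]
    · simp [Finset.card_erase_of_mem]
    · intro x hx
      have hx0 : -x ≠ 0 := neg_ne_zero.mpr (Finset.ne_of_mem_erase hx)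
      rw [← Ncube_cube_mul s hx0 1]
      congr 1
      ring

lemma Ncube_one (z : F) [DecidableEq F] :
    Ncube F 1 z = (Finset.univ.filter fun x : F ↦ x ^ 3 = z).card := by
  rw [Ncube_succ, Finset.card_filter]
  simp only [Ncube_zero, sub_eq_zero, eq_comm (a := z)]

lemma Ncube_two (z : F) : Ncube F 2 z = ∑ a : F, Ncube F 1 a * Ncube F 1 (z - a) := by
  classical
  rw [Ncube_succ, ← Finset.sum_fiberwise Finset.univ (fun x : F ↦ x ^ 3)]
  refine Finset.sum_congr rfl fun a _ ↦ ?_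
  rw [Ncube_one a, ← smul_eq_mul, ← Finset.sum_const]
  refine Finset.sum_congr rfl fun x hx ↦ ?_
  rw [(Finset.mem_filter.mp hx).2]

lemma Ncube_one_zero : Ncube F 1 (0 : F) = 1 := by
  classical
  rw [Ncube_one, Finset.card_eq_one]
  exact ⟨0, by ext; simp⟩

lemma Ncube_one_cube (hq : 3 ∣ Fintype.card F - 1) {b : F} (hb : b ≠ 0) :
    Ncube F 1 (b ^ 3) = 3 := by
  classical
  obtain ⟨ω, hω⟩ : ∃ ω : F, IsPrimitiveRoot ω 3 := by
    obtain ⟨m, hm⟩ := hq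
    obtain ⟨g, hg⟩ := IsCyclic.exists_ofOrder_eq_natCard (α := Fˣ)
    have hpos := Fintype.one_lt_card (α := F)
    rw [Nat.card_eq_fintype_card, Fintype.card_units] at hg
    have h := (IsPrimitiveRoot.orderOf g).pow (orderOf_pos g) (hg.trans (hm.trans (mul_comm _ _)))
    exact ⟨_, IsPrimitiveRoot.coe_units_iff.mpr h⟩
  rw [← mul_one (b ^ 3), Ncube_cube_mul 1 hb, Ncube_one]
  refine Eq.trans (congrArg Finset.card ?_) hω.card_nthRootsFinset
  ext x
  simp [Polynomial.mem_nthRootsFinset]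

/-- The number of cube roots of `a` expressed through a multiplicative function of order three. -/
lemma Ncube_one_eq (hq : 3 ∣ Fintype.card F - 1) {R : Type*} [CommRing R] [IsDomain R]
    (f : F →* R) (h0 : f 0 = 0) (h3 : ∀ x ≠ 0, f x ^ 3 = 1) (h1 : ∃ x ≠ 0, f x ≠ 1) (a : F) :
    (Ncube F 1 a : R) = 1 + f a + f a ^ 2 := by
  classical
  by_cases ha : a = 0
  · simp [ha, h0, Ncube_one_zero]
  by_cases hc : ∃ b, b ^ 3 = a
  · obtain ⟨b, rfl⟩ := hc
    have hb : b ≠ 0 := by rintro rfl; simp at ha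
    rw [Ncube_one_cube hq hb, map_pow, h3 b hb]
    norm_num
  · have hN : Ncube F 1 a = 0 := by
      rw [Ncube_one, Finset.card_eq_zero, Finset.filter_eq_empty_iff]
      exact fun x _ hx ↦ hc ⟨x, hx⟩
    obtain ⟨g, hg⟩ := IsCyclic.exists_generator (α := Fˣ)
    have hfg : f g ≠ 1 := by
      intro hfg
      obtain ⟨x, hx0, hx⟩ := h1
      obtain ⟨n, hn⟩ := (mem_powers_iff_mem_zpowers).mpr (hg (Units.mk0 x hx0))
      apply hx
      have : x = (g : F) ^ n := by
        simpa using (congrArg Units.val hn).symm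
      rw [this, map_pow, hfg, one_pow]
    have hfa : f a ≠ 1 := by
      obtain ⟨n, hn⟩ := (mem_powers_iff_mem_zpowers).mpr (hg (Units.mk0 a ha))
      have hag : a = (g : F) ^ n := by
        simpa using (congrArg Units.val hn).symm
      have hn3 : ¬ 3 ∣ n := by
        rintro ⟨k, rfl⟩
        exact hc ⟨(g : F) ^ k, by rw [hag]; ring⟩
      intro hfa
      rw [hag, map_pow] at hfa
      have hprim : orderOf (f g) = 3 := orderOf_eq_prime (h3 _ g.ne_zero) hfg
      exact hn3 (hprim ▸ orderOf_dvd_of_pow_eq_one hfa)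
    have hz : (f a - 1) * (1 + f a + f a ^ 2) = 0 := by
      linear_combination h3 a ha
    rw [hN, Nat.cast_zero]
    exact ((mul_eq_zero.mp hz).resolve_left (sub_ne_zero.mpr hfa)).symm

end Counting

section Representations

lemma sq_eq_sq_of_four_mul_eq_of_isCoprime {p k : ℕ} (hp : p.Prime) (hp2 : p ≠ 2) (hk : 0 < k)
    {a b c d : ℤ} (hab : 4 * (p : ℤ) ^ k = a ^ 2 + 27 * b ^ 2)
    (hcd : 4 * (p : ℤ) ^ k = c ^ 2 + 27 * d ^ 2)
    (ha : IsCoprime a (p : ℤ)) (hc : IsCoprime c (p : ℤ)) : a ^ 2 = c ^ 2 := by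
  have hpZ : Prime (p : ℤ) := Nat.prime_iff_prime_int.mp hp
  have ndvd : ∀ {x : ℤ}, IsCoprime x (p : ℤ) → ¬ (p : ℤ) ∣ x := fun hx h ↦
    hpZ.irreducible.coprime_iff_not_dvd.mp hx.symm h
  obtain ⟨q, hq⟩ : ∃ q : ℤ, q = (p : ℤ) ^ k := ⟨_, rfl⟩
  have hpq : (p : ℤ) ∣ q := hq ▸ dvd_pow_self _ hk.ne'
  have hq0 : 0 < q := hq ▸ pow_pos (by exact_mod_cast hp.pos) k
  rw [← hq] at hab hcd
  have key : ∀ e : ℤ, e ^ 2 = b ^ 2 → q ∣ a * d - c * e → a ^ 2 = c ^ 2 := by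
    rintro e he ⟨m, hm⟩
    rw [← he] at hab
    have h1 : (a * c + 27 * d * e) ^ 2 + 27 * (a * d - c * e) ^ 2 = 16 * q ^ 2 := by
      linear_combination (-4 * q) * hab - (a ^ 2 + 27 * e ^ 2) * hcd
    have hm0 : m = 0 := by
      by_contra hm0
      have : 1 ≤ m ^ 2 := by have := sq_pos_of_ne_zero hm0; omega
      rw [hm] at h1
      nlinarith [sq_nonneg (a * c + 27 * d * e), pow_pos hq0 2]
    rw [hm0, mul_zero, sub_eq_zero] at hm
    have h3 : (4 * q) * (d ^ 2 - e ^ 2) = 0 := by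
      linear_combination d ^ 2 * hab - e ^ 2 * hcd + (a * d + c * e) * hm
    have h4 := (mul_eq_zero.mp h3).resolve_left (by positivity)
    linarith
  have hdvd : q ∣ (a * d - c * b) * (a * d - c * -b) :=
    ⟨4 * (d ^ 2 - b ^ 2), by linear_combination (-d ^ 2) * hab + b ^ 2 * hcd⟩
  by_cases h1 : (p : ℤ) ∣ a * d - c * b
  · have h2 : ¬ (p : ℤ) ∣ a * d - c * -b := by
      intro h2
      have h3 : (p : ℤ) ∣ 2 * a * d := by
        rw [show 2 * a * d = (a * d - c * b) + (a * d - c * -b) by ring]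
        exact dvd_add h1 h2
      rcases hpZ.dvd_or_dvd h3 with h | h
      · rcases hpZ.dvd_or_dvd h with h | h
        · exact hp2 ((Nat.prime_dvd_prime_iff_eq hp Nat.prime_two).mp (by exact_mod_cast h))
        · exact ndvd ha h
      · refine ndvd hc (hpZ.dvd_of_dvd_pow (n := 2) ?_)
        have : c ^ 2 = 4 * q - 27 * d * d := by linear_combination -hcd
        rw [this]
        exact dvd_sub (hpq.mul_left _) (h.mul_left _)
    have hcop : IsCoprime q (a * d - c * -b) :=
      hq ▸ (hpZ.irreducible.coprime_iff_not_dvd.mpr h2).pow_left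
    exact key b rfl (hcop.dvd_of_dvd_mul_right hdvd)
  · have hcop : IsCoprime q (a * d - c * b) :=
      hq ▸ (hpZ.irreducible.coprime_iff_not_dvd.mpr h1).pow_left
    exact key (-b) (by ring) (hcop.dvd_of_dvd_mul_left hdvd)

lemma dvd_of_dvd_sq_add_twentySeven_mul_sq {p : ℕ} (hp : p.Prime) (hp2 : p ≠ 2)
    (hp3 : p % 3 = 2) {c d : ℤ} (h : (p : ℤ) ∣ c ^ 2 + 27 * d ^ 2) :
    (p : ℤ) ∣ c ∧ (p : ℤ) ∣ d := by
  have : Fact p.Prime := ⟨hp⟩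
  have hpZ : Prime (p : ℤ) := Nat.prime_iff_prime_int.mp hp
  have hd : (p : ℤ) ∣ d := by
    by_contra hd
    rw [← ZMod.intCast_zmod_eq_zero_iff_dvd] at h hd
    push_cast at h
    have h2 : (2 : ZMod p) ≠ 0 := fun h ↦
      hp2 ((Nat.prime_dvd_prime_iff_eq hp Nat.prime_two).mp
        ((ZMod.natCast_eq_zero_iff 2 p).mp (by exact_mod_cast h)))
    have h3 : (3 : ZMod p) ≠ 0 := fun h ↦ by
      have := (Nat.prime_dvd_prime_iff_eq hp Nat.prime_three).mp
        ((ZMod.natCast_eq_zero_iff 3 p).mp (by exact_mod_cast h))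
      omega
    have h6 : (6 * d : ZMod p) ≠ 0 := by
      rw [show (6 : ZMod p) = 2 * 3 by norm_num]
      exact mul_ne_zero (mul_ne_zero h2 h3) hd
    obtain ⟨ω, hω⟩ : ∃ ω : ZMod p, ω * (6 * d) = c - 3 * d := ⟨_, div_mul_cancel₀ _ h6⟩
    have hω1 : ω ^ 2 + ω + 1 = 0 := by
      have : (ω ^ 2 + ω + 1) * (6 * d) ^ 2 = 0 := by
        linear_combination h + (ω * (6 * d) + (c - 3 * d) + 6 * d) * hω
      exact (mul_eq_zero.mp this).resolve_right (pow_ne_zero 2 h6)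
    have hne : ω ≠ 1 := by
      rintro rfl
      exact h3 (by linear_combination hω1)
    have hω0 : ω ≠ 0 := by
      rintro rfl
      simp at hω1
    have hord : orderOf ω = 3 := orderOf_eq_prime (by linear_combination (ω - 1) * hω1) hne
    have := ZMod.orderOf_dvd_card_sub_one hω0
    rw [hord] at this
    have := hp.two_le
    omega
  refine ⟨hpZ.dvd_of_dvd_pow (n := 2) ?_, hd⟩
  rw [sq d, ← mul_assoc] at h
  exact (dvd_add_left (hd.mul_left _)).mp h

lemma eq_zero_of_four_mul_pow_eq {p : ℕ} (hp : p.Prime) (hp3 : p % 3 = 2) (m : ℕ) {c d : ℤ}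
    (h : 4 * (p : ℤ) ^ (2 * m) = c ^ 2 + 27 * d ^ 2) : d = 0 := by
  have hp0 : (p : ℤ) ≠ 0 := by exact_mod_cast hp.ne_zero
  induction m generalizing c d with
  | zero =>
    by_contra hd
    have := sq_pos_of_ne_zero hd
    rw [mul_zero, pow_zero] at h
    linarith [sq_nonneg c]
  | succ m ih =>
    have hdvd : (p : ℤ) ∣ c ∧ (p : ℤ) ∣ d := by
      by_cases hp2 : p = 2
      · subst hp2
        have h8 : 4 * (2 * (2 ^ (2 * m + 1))) = c ^ 2 + 27 * d ^ 2 := by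
          rw [← h]
          push_cast
          ring
        have hodd : ∀ z : ℤ, z % 2 = 1 → z ^ 2 % 8 = 1 := fun z hz ↦ by
          have := Int.eight_dvd_sq_sub_one_of_odd (Int.odd_iff.mpr hz)
          omega
        have heven : ∀ z : ℤ, z % 2 = 0 → z ^ 2 % 2 = 0 := fun z hz ↦ by
          simp [pow_two, Int.mul_emod, hz]
        rcases Int.emod_two_eq c with hc | hc <;> rcases Int.emod_two_eq d with hd | hd
        · exact ⟨by push_cast; omega, by push_cast; omega⟩
        · have := heven c hc
          have := hodd d hd
          omega
        · have := hodd c hc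
          have := heven d hd
          omega
        · have := hodd c hc
          have := hodd d hd
          omega
      · refine dvd_of_dvd_sq_add_twentySeven_mul_sq hp hp2 hp3 (h ▸ ?_)
        exact (dvd_pow_self _ (by omega)).mul_left _
    obtain ⟨⟨x, rfl⟩, ⟨y, rfl⟩⟩ := hdvd
    have : y = 0 := ih (c := x) (mul_left_cancel₀ (pow_ne_zero 2 hp0) (by linear_combination h))
    rw [this, mul_zero]

lemma not_dvd_choose_of_three_mul_add_one_eq_pow {p : ℕ} (hp : p.Prime) (hp3 : p % 3 = 1)
    (k : ℕ) {m : ℕ} (hm : 3 * m + 1 = p ^ k) : ¬ p ∣ (2 * m).choose m := by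
  have : Fact p.Prime := ⟨hp⟩
  induction k generalizing m with
  | zero =>
    have : m = 0 := by simpa using hm
    simpa [this] using hp.ne_one
  | succ k ih =>
    obtain ⟨t, ht⟩ : ∃ t, p = 3 * t + 1 := ⟨p / 3, by omega⟩
    have hpk : p ^ k % 3 = 1 := by simp [Nat.pow_mod, hp3]
    obtain ⟨n, hn⟩ : ∃ n, 3 * n + 1 = p ^ k := ⟨p ^ k / 3, by omega⟩
    have hmn : m = t + p * n := by
      rw [pow_succ, ← hn] at hm
      have : 3 * m = 3 * (t + p * n) := by linarith [ht]
      omega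
    have e1 : m % p = t := by rw [hmn, Nat.add_mul_mod_self_left, Nat.mod_eq_of_lt (by omega)]
    have e2 : m / p = n := by
      rw [hmn, Nat.add_mul_div_left _ _ hp.pos, Nat.div_eq_of_lt (by omega), zero_add]
    have e0 : 2 * m = 2 * t + p * (2 * n) := by rw [hmn]; ring
    have e3 : 2 * m % p = 2 * t := by
      rw [e0, Nat.add_mul_mod_self_left, Nat.mod_eq_of_lt (by omega)]
    have e4 : 2 * m / p = 2 * n := by
      rw [e0, Nat.add_mul_div_left _ _ hp.pos, Nat.div_eq_of_lt (by omega), zero_add]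
    have hl := Choose.choose_modEq_choose_mod_mul_choose_div_nat (p := p) (n := 2 * m) (k := m)
    rw [e1, e2, e3, e4] at hl
    rw [hl.dvd_iff dvd_rfl, hp.dvd_mul, not_or]
    refine ⟨fun h ↦ ?_, ih hn⟩
    have : p ∣ (2 * t).factorial := by
      rw [← Nat.choose_mul_factorial_mul_factorial (show t ≤ 2 * t by omega), mul_assoc]
      exact h.mul_right _
    have := hp.dvd_factorial.mp this
    omega

end Representations

section CharacterSums

variable {F : Type} [Field F] [Fintype F]

lemma exists_eq_add_mul_of_mem_adjoin {R : Type*} [CommRing R] {ω z : R}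
    (hω : ω ^ 2 + ω + 1 = 0) (hz : z ∈ Algebra.adjoin ℤ {ω}) :
    ∃ u v : ℤ, z = u + v * ω := by
  induction hz using Algebra.adjoin_induction with
  | mem x hx => exact ⟨0, 1, by simpa using hx⟩
  | algebraMap r => exact ⟨r, 0, by simp⟩
  | add x y _ _ hx hy =>
    obtain ⟨a, b, rfl⟩ := hx
    obtain ⟨c, d, rfl⟩ := hy
    exact ⟨a + c, b + d, by push_cast; ring⟩
  | mul x y _ _ hx hy =>
    obtain ⟨a, b, rfl⟩ := hx
    obtain ⟨c, d, rfl⟩ := hy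
    exact ⟨a * c - b * d, a * d + b * c - b * d, by
      push_cast
      linear_combination (b * d : R) * hω⟩

lemma Ncube_two_one_eq_jacobiSum {R : Type*} [CommRing R] [IsDomain R] {χ : MulChar F R}
    (hχ : orderOf χ = 3) :
    (Ncube F 2 1 : R) = Fintype.card F - 2 + jacobiSum χ χ + jacobiSum χ⁻¹ χ⁻¹ := by
  have hq : 3 ∣ Fintype.card F - 1 := hχ ▸ χ.orderOf_dvd_card_sub_one
  have hχ3 : χ ^ 3 = 1 := hχ ▸ pow_orderOf_eq_one χ
  have hχ1 : χ ≠ 1 := by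
    rintro rfl
    simp at hχ
  have hinv : χ⁻¹ = χ ^ 2 := inv_eq_of_mul_eq_one_right (by rw [← pow_succ', hχ3])
  have h3 : ∀ x ≠ 0, χ x ^ 3 = 1 := fun x hx ↦ by
    rw [← χ.pow_apply' (by norm_num), hχ3, MulChar.one_apply (isUnit_iff_ne_zero.mpr hx)]
  have hne : ∃ x ≠ 0, χ x ≠ 1 := by
    obtain ⟨u, hu⟩ := χ.ne_one_iff.mp hχ1
    exact ⟨u, u.ne_zero, hu⟩
  have hneg : χ (-1) = 1 := by
    rw [← h3 (-1) (by simp), ← map_pow]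
    norm_num
  have hN : ∀ a, (Ncube F 1 a : R) = 1 + χ a + χ⁻¹ a := fun a ↦ by
    rw [hinv, χ.pow_apply' (by norm_num)]
    exact Ncube_one_eq hq χ.toMonoidHom χ.map_zero h3 hne a
  have hsub : ∀ f : F → R, ∑ a, f (1 - a) = ∑ a, f a := (Equiv.subLeft (1 : F)).sum_comp
  have hexp : ∀ a, ((1 : R) + χ a + χ⁻¹ a) * (1 + χ (1 - a) + χ⁻¹ (1 - a)) =
      1 + χ a + χ⁻¹ a + χ (1 - a) + χ⁻¹ (1 - a) + χ a * χ (1 - a) + χ a * χ⁻¹ (1 - a)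
        + χ⁻¹ a * χ (1 - a) + χ⁻¹ a * χ⁻¹ (1 - a) := fun a ↦ by ring
  rw [Ncube_two]
  push_cast
  simp only [hN, hexp, Finset.sum_add_distrib]
  rw [hsub (χ ·), hsub (χ⁻¹ ·), MulChar.sum_eq_zero_of_ne_one hχ1,
    MulChar.sum_eq_zero_of_ne_one (inv_ne_one.mpr hχ1)]
  have h := jacobiSum_nontrivial_inv hχ1
  have h' := jacobiSum_comm χ χ⁻¹
  simp only [jacobiSum] at h h' ⊢
  rw [← h', h, hneg]
  simp only [Finset.sum_const, Finset.card_univ, nsmul_eq_mul]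
  ring

lemma exists_Ncube_two_one_eq (hq : 3 ∣ Fintype.card F - 1) :
    ∃ a b : ℤ, a % 3 = 1 ∧ 4 * (Fintype.card F : ℤ) = a ^ 2 + 27 * b ^ 2 ∧
      (Ncube F 2 1 : ℤ) = Fintype.card F - 2 + a := by
  have hω := Complex.isPrimitiveRoot_exp 3 (by norm_num)
  obtain ⟨χ, hχ⟩ := MulChar.exists_mulChar_orderOf F hq hω
  generalize Complex.exp _ = ω at hω
  have hω3 : ω ^ 3 = 1 := hω.pow_eq_one
  have hωsum : ω ^ 2 + ω + 1 = 0 := by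
    have := hω.geom_sum_eq_zero (by norm_num)
    simp only [Finset.sum_range_succ, Finset.sum_range_zero] at this
    linear_combination this
  have hstar : star ω = ω ^ 2 := by
    have hn : ‖ω‖ = 1 := Complex.norm_eq_one_of_pow_eq_one hω3 (by norm_num)
    rw [Complex.star_def, ← Complex.inv_eq_conj hn]
    exact inv_eq_of_mul_eq_one_right (by rw [← pow_succ', hω3])
  have hχ3 : χ ^ 3 = 1 := hχ ▸ pow_orderOf_eq_one χ
  have hχ1 : χ ≠ 1 := by
    rintro rfl
    simp at hχ
  have hχχ : χ * χ ≠ 1 := by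
    intro h
    apply hχ1
    rwa [pow_succ, sq, h, one_mul] at hχ3
  obtain ⟨z, hz, hJ⟩ := exists_jacobiSum_eq_neg_one_add (by norm_num) hχ3 hχ3 hq hω
  obtain ⟨u, v, rfl⟩ := exists_eq_add_mul_of_mem_adjoin hωsum hz
  have hJ' : jacobiSum χ⁻¹ χ⁻¹ = star (jacobiSum χ χ) := by
    rw [← MulChar.star_eq_inv]
    simp [jacobiSum, MulChar.star_apply]
  have hchar : ringChar ℂ ≠ ringChar F := by
    rw [ringChar.eq_zero]
    exact (CharP.ringChar_ne_zero_of_finite F).symm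
  have hprod := jacobiSum_mul_jacobiSum_inv hchar hχ1 hχ1 hχχ
  have hN := Ncube_two_one_eq_jacobiSum hχ
  have hJ1 : jacobiSum χ χ = (3 * v - 1) + 3 * (v - u) * ω := by
    rw [hJ]
    linear_combination (u - 3 * v + v * ω) * hωsum
  have hJ2 : jacobiSum χ⁻¹ χ⁻¹ = (3 * v - 1) + 3 * (v - u) * ω ^ 2 := by
    rw [hJ', hJ1]
    simp [← hstar]
  rw [hJ1, hJ2] at hprod hN
  refine ⟨3 * v + 3 * u - 2, v - u, by omega, ?_, ?_⟩
  · apply Int.cast_injective (α := ℂ)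
    push_cast
    rw [← hprod]
    linear_combination (4 * (3 * (v - u : ℂ)) ^ 2 * (ω - 1) + 4 * (3 * v - 1) * (3 * (v - u))) * hωsum
  · apply Int.cast_injective (α := ℂ)
    push_cast
    rw [hN]
    linear_combination (3 * (v - u : ℂ)) * hωsum

lemma sum_pow_of_lt_two_mul_card_sub_one {n : ℕ} (hn : n < 2 * (Fintype.card F - 1)) :
    ∑ x : F, x ^ n = if n = Fintype.card F - 1 then -1 else 0 := by
  classical
  rcases n.eq_zero_or_pos with rfl | hn0
  · have := Fintype.one_lt_card (α := F)
    rw [if_neg (by omega)]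
    simp
  have h : ∑ x : F, x ^ n = ∑ x : Fˣ, (x ^ n : F) := by
    rw [← Finset.add_sum_erase _ _ (Finset.mem_univ (0 : F)), zero_pow hn0.ne', zero_add]
    symm
    refine Finset.sum_bij (fun x _ ↦ (x : F)) (by simp) (fun _ _ _ _ h ↦ Units.ext h) ?_ (by simp)
    exact fun b hb ↦ ⟨Units.mk0 b (Finset.ne_of_mem_erase hb), by simp⟩
  rw [h, FiniteField.sum_pow_units]
  refine if_congr ⟨?_, fun h ↦ h ▸ dvd_rfl⟩ rfl rfl
  rintro ⟨t, rfl⟩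
  obtain rfl : t = 1 := by
    have h1 : t < 2 := lt_of_mul_lt_mul_left' (by rwa [mul_comm 2] at hn)
    have h2 : t ≠ 0 := by rintro rfl; simp at hn0
    omega
  exact mul_one _

lemma sum_pow_mul_one_sub_pow_s19 {i j : ℕ} (hi : i ≤ Fintype.card F - 1)
    (hij : i + j < 2 * (Fintype.card F - 1)) :
    ∑ x : F, x ^ i * (1 - x) ^ j =
      -((-1) ^ (Fintype.card F - 1 - i) * (j.choose (Fintype.card F - 1 - i) : F)) := by
  have hexp : ∀ x : F, x ^ i * (1 - x) ^ j =
      ∑ l ∈ Finset.range (j + 1), (-1) ^ l * (j.choose l : F) * x ^ (i + l) := fun x ↦ by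
    rw [sub_eq_neg_add, add_pow, Finset.mul_sum]
    refine Finset.sum_congr rfl fun l _ ↦ ?_
    rw [neg_pow, one_pow]
    ring
  simp only [hexp]
  rw [Finset.sum_comm]
  simp only [← Finset.mul_sum]
  rw [Finset.sum_congr rfl (g := fun l ↦ if l = Fintype.card F - 1 - i then
    -((-1) ^ l * (j.choose l : F)) else 0)]
  · rw [Finset.sum_ite_eq']
    split_ifs with h
    · rfl
    · rw [Nat.choose_eq_zero_of_lt (by rw [Finset.mem_range] at h; omega)]
      simp
  · intro l hl
    have hl := Finset.mem_range.mp hl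
    rw [sum_pow_of_lt_two_mul_card_sub_one (by omega)]
    split_ifs with h1 h2 h2
    · ring
    · omega
    · omega
    · ring

lemma Ncube_two_one_cast_eq {m : ℕ} (hm : 3 * m = Fintype.card F - 1) (hm2 : Even m) :
    (Ncube F 2 1 : F) = -2 - (2 * m).choose m := by
  classical
  have hm0 : 0 < m := by
    have := Fintype.one_lt_card (α := F)
    omega
  have hN : ∀ a : F, (Ncube F 1 a : F) = 1 + a ^ m + (a ^ m) ^ 2 := by
    refine Ncube_one_eq (Dvd.intro m hm) (powMonoidHom m) (by simp [hm0.ne']) ?_ ?_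
    · intro x hx
      rw [powMonoidHom_apply, ← pow_mul, mul_comm, hm, FiniteField.pow_card_sub_one_eq_one x hx]
    · by_contra! h
      obtain ⟨g, hg⟩ := IsCyclic.exists_ofOrder_eq_natCard (α := Fˣ)
      have hgm : g ^ m = 1 := Units.ext (by simpa using h g g.ne_zero)
      have := Nat.le_of_dvd hm0 (orderOf_dvd_of_pow_eq_one hgm)
      rw [hg, Nat.card_eq_fintype_card, Fintype.card_units] at this
      omega
  have hS : ∀ i j : ℕ, i ≤ 2 → j ≤ 2 → ∑ x : F, x ^ (i * m) * (1 - x) ^ (j * m) =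
      -((j * m).choose ((3 - i) * m) : F) := fun i j hi hj ↦ by
    have hi' : i * m ≤ 2 * m := Nat.mul_le_mul_right m hi
    have hj' : j * m ≤ 2 * m := Nat.mul_le_mul_right m hj
    rw [sum_pow_mul_one_sub_pow_s19 (by omega) (by omega), ← hm, ← Nat.sub_mul,
      (hm2.mul_left _).neg_one_pow, one_mul]
  have hexp : ∀ a : F, (1 + a ^ m + (a ^ m) ^ 2) * (1 + (1 - a) ^ m + ((1 - a) ^ m) ^ 2) =
      ∑ i ∈ Finset.range 3, ∑ j ∈ Finset.range 3, a ^ (i * m) * (1 - a) ^ (j * m) := fun a ↦ by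
    simp only [Finset.sum_range_succ, Finset.sum_range_zero]
    ring
  rw [Ncube_two]
  push_cast
  simp only [hN, hexp]
  simp only [Finset.sum_comm (s := Finset.univ)]
  rw [Finset.sum_congr rfl fun i hi ↦ Finset.sum_congr rfl fun j hj ↦ hS i j
    (Nat.lt_succ_iff.mp (Finset.mem_range.mp hi)) (Nat.lt_succ_iff.mp (Finset.mem_range.mp hj))]
  have hz : ∀ {i j : ℕ}, i < j → (i * m).choose (j * m) = 0 := fun h ↦
    Nat.choose_eq_zero_of_lt (Nat.mul_lt_mul_of_pos_right h hm0)
  simp [Finset.sum_range_succ, hz, Nat.choose_eq_zero_of_lt, hm0]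
  ring

end CharacterSums

/-- `N₂(0) = 3q - 2` and `N₃(0) = q² + cq - c`, where `c` is determined by
`4q = c² + 27d²` for some integer `d`, `c ≡ 1 (mod 3)`, and `gcd(c,p) = 1`
whenever `p ≡ 1 (mod 3)`. -/
theorem N2_N3_at_zero
    (p k q : ℕ) [Fact p.Prime] (hk : 0 < k) (hq : q = p ^ k) (hq3 : q % 3 = 1)
    (F : Type) [Field F] [Fintype F] (hF : Fintype.card F = q)
    (c d : ℤ) (h4q : 4 * (q : ℤ) = c ^ 2 + 27 * d ^ 2) (hc3 : c % 3 = 1)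
    (hcp : p % 3 = 1 → IsCoprime c (p : ℤ)) :
    Ncube F 2 0 = 3 * q - 2
    ∧ (Ncube F 3 0 : ℤ) = (q : ℤ) ^ 2 + c * (q : ℤ) - c := by
  have hp : p.Prime := Fact.out
  have h3 : 3 ∣ Fintype.card F - 1 := by omega
  have hq1 : 1 ≤ q := by omega
  have hN2 : Ncube F 2 0 = 3 * q - 2 := by
    have h1 := Ncube_one_cube h3 (one_ne_zero (α := F))
    rw [one_pow] at h1
    rw [Ncube_succ_zero, Ncube_one_zero, h1, hF]
    omega
  obtain ⟨a, b, ha3, hab, hN⟩ := exists_Ncube_two_one_eq h3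
  rw [hF] at hab hN
  have hac : a ^ 2 = c ^ 2 := by
    have h4q' := h4q
    have hab' := hab
    rw [hq] at h4q' hab'
    push_cast at h4q' hab'
    have hp3 : p % 3 = 1 ∨ p % 3 = 2 := by
      have : p % 3 ≠ 0 := fun h ↦ by
        rw [hq, Nat.pow_mod, h, zero_pow hk.ne'] at hq3
        simp at hq3
      omega
    rcases hp3 with hp3 | hp3
    · have hp2 : p ≠ 2 := by rintro rfl; simp at hp3
      refine sq_eq_sq_of_four_mul_eq_of_isCoprime hp hp2 hk hab' h4q' ?_ (hcp hp3)
      obtain ⟨m, hm⟩ := h3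
      have hchoose := not_dvd_choose_of_three_mul_add_one_eq_pow hp hp3 k (m := m) (by omega)
      have : CharP F p := charP_of_card_eq_prime_pow (hF.trans hq)
      have hm2 : Even m := by
        have hodd : Odd (p ^ k) := (hp.odd_of_ne_two hp2).pow
        rw [← hq] at hodd
        have := Nat.odd_iff.mp hodd
        rw [Nat.even_iff]
        omega
      have hNF := Ncube_two_one_cast_eq hm.symm hm2
      have hqF : (q : F) = 0 := hF ▸ Nat.cast_card_eq_zero F
      have hN' : (Ncube F 2 1 : F) = q - 2 + a := by exact_mod_cast congrArg (Int.cast (R := F)) hN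
      rw [isCoprime_comm, (Nat.prime_iff_prime_int.mp hp).irreducible.coprime_iff_not_dvd]
      intro hpa
      rw [← CharP.intCast_eq_zero_iff F p] at hpa
      apply hchoose
      rw [← CharP.cast_eq_zero_iff F p]
      linear_combination hNF - hN' - hqF - hpa
    · obtain ⟨m, rfl⟩ : Even k := by
        by_contra hodd
        obtain ⟨m, rfl⟩ := Nat.not_even_iff_odd.mp hodd
        rw [hq, Nat.pow_mod, hp3, pow_succ, pow_mul, Nat.mul_mod, Nat.pow_mod] at hq3
        simp at hq3
      rw [← two_mul] at h4q' hab'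
      have hb := eq_zero_of_four_mul_pow_eq hp hp3 m hab'
      have hd := eq_zero_of_four_mul_pow_eq hp hp3 m h4q'
      rw [hb] at hab'
      rw [hd] at h4q'
      linarith
  obtain rfl : a = c := by
    rcases sq_eq_sq_iff_eq_or_eq_neg.mp hac with h | h
    · exact h
    · omega
  refine ⟨hN2, ?_⟩
  rw [Ncube_succ_zero, hN2, hF]
  push_cast [hN, Nat.cast_sub hq1, Nat.cast_sub (show 2 ≤ 3 * q by omega)]
  ring
end
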